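/- Let C₅ > 0 and let Φ : ℂ × ℂ → ℂ be continuous with |Φ(c, w)| ≤ C₅ for all (c, w), Φ(c, w) = 0 whenever |c| ≥ 1, and Lipschitz in the second variable: there is L > 0 with |Φ(c, w) − Φ(c, w′)| ≤ L |w − w′| for all c, w, w′ ∈ ℂ. Then for every z ∈ ℂ there exists a bounded continuous function f : ℂ → ℂ with sup_{c ∈ ℂ} |f(c)| ≤ |z| + 2C₅, satisfying f(c) = z + 𝒦f(c) for all c ∈ ℂ and f(c) → z as c → ∞. -/

import Mathlib

open MeasureTheory

/-- The operator `𝒦`: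
`𝒦 f (c) = -(1/π) ∬_ℂ Φ(ζ, f(ζ))/(ζ - c) dξ dη`. -/
noncomputable def KOp (Φ : ℂ → ℂ → ℂ) (f : ℂ → ℂ) (c : ℂ) : ℂ :=
  -(Real.pi)⁻¹ • ∫ ζ : ℂ, Φ ζ (f ζ) / (ζ - c)

/-- The Cauchy transform `a ↦ (c ↦ -(1/π) ∬ a(ζ)/(ζ - c) dξ dη)`. -/
noncomputable def cauchyTransform (a : ℂ → ℂ) (c : ℂ) : ℂ :=
  -(Real.pi)⁻¹ • ∫ ζ : ℂ, a ζ / (ζ - c)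

theorem KOp_eq_cauchyTransform (Φ : ℂ → ℂ → ℂ) (f : ℂ → ℂ) :
    KOp Φ f = cauchyTransform fun ζ => Φ ζ (f ζ) := rfl

/-- Measurable functions bounded by `B` and vanishing outside the open unit disk. -/
structure DiskBounded (B : ℝ) (a : ℂ → ℂ) : Prop where
  measurable : Measurable a
  norm_le : ∀ ζ, ‖a ζ‖ ≤ B
  eq_zero : ∀ ζ, 1 ≤ ‖ζ‖ → a ζ = 0

/-- The positive part of `1/|ζ| - 1`. -/
noncomputable def truncInvNorm (ζ : ℂ) : ℝ := max (‖ζ‖⁻¹ - 1) 0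

theorem mul_max_inv_sub_one {y : ℝ} (hy : 0 < y) :
    y * max (y⁻¹ - 1) 0 = (Set.Ioc (0 : ℝ) 1).indicator (fun y => 1 - y) y := by
  by_cases h : y ≤ 1
  · rw [Set.indicator_of_mem (Set.mem_Ioc.2 ⟨hy, h⟩), max_eq_left (by linarith [(one_le_inv₀ hy).2 h])]
    field_simp
  · rw [Set.indicator_of_notMem (fun h' => h h'.2), max_eq_right, mul_zero]
    linarith [inv_le_one_of_one_le₀ (not_le.1 h).le]

theorem integrable_truncInvNorm : Integrable truncInvNorm := by
  refine (integrable_fun_norm_addHaar (E := ℂ) volume (f := fun r : ℝ => max (r⁻¹ - 1) 0)).2 ?_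
  rw [Complex.finrank_real_complex]
  refine IntegrableOn.congr_fun (f := (Set.Ioc (0 : ℝ) 1).indicator fun y => 1 - y) ?_ ?_
    measurableSet_Ioi
  · refine Integrable.integrableOn ((integrable_indicator_iff measurableSet_Ioc).2 ?_)
    exact ((continuous_const.sub continuous_id).integrableOn_Icc).mono_set Set.Ioc_subset_Icc_self
  · intro y hy
    simpa using (mul_max_inv_sub_one hy).symm

theorem integral_truncInvNorm : ∫ ζ, truncInvNorm ζ = Real.pi := by
  have h := integral_fun_norm_addHaar (E := ℂ) volume (fun r : ℝ => max (r⁻¹ - 1) 0)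
  refine h.trans ?_
  rw [Complex.finrank_real_complex]
  have h1 : ∫ y in Set.Ioi (0 : ℝ), y ^ (2 - 1) • max (y⁻¹ - 1) 0 = 1 / 2 := by
    rw [setIntegral_congr_fun (g := (Set.Ioc (0 : ℝ) 1).indicator fun y => 1 - y)
      measurableSet_Ioi fun y hy => by simpa using mul_max_inv_sub_one hy,
      setIntegral_indicator measurableSet_Ioc,
      Set.inter_eq_right.2 Set.Ioc_subset_Ioi_self,
      ← intervalIntegral.integral_of_le zero_le_one,
      intervalIntegral.integral_sub (by simp) (by simp)]
    norm_num
  rw [h1, measureReal_def, Complex.volume_ball]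
  simp
  ring

/-- An integrable majorant of `1/|ζ - c|` on the unit disk. -/
noncomputable def kernelBound (c ζ : ℂ) : ℝ :=
  (Metric.ball (0 : ℂ) 1).indicator 1 ζ + truncInvNorm (ζ - c)

theorem integrable_indicator_ball :
    Integrable ((Metric.ball (0 : ℂ) 1).indicator (1 : ℂ → ℝ)) :=
  (integrable_indicator_iff measurableSet_ball).2
    (integrableOn_const (measure_ball_lt_top.ne) (by simp))

theorem integrable_kernelBound (c : ℂ) : Integrable (kernelBound c) :=
  integrable_indicator_ball.add (integrable_truncInvNorm.comp_sub_right c)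

theorem integral_kernelBound (c : ℂ) : ∫ ζ, kernelBound c ζ = 2 * Real.pi := by
  unfold kernelBound
  rw [integral_add integrable_indicator_ball (integrable_truncInvNorm.comp_sub_right c),
    integral_sub_right_eq_self truncInvNorm c, integral_truncInvNorm,
    integral_indicator_one measurableSet_ball, measureReal_def, Complex.volume_ball]
  simp
  ring

theorem kernelBound_nonneg (c ζ : ℂ) : 0 ≤ kernelBound c ζ :=
  add_nonneg (Set.indicator_nonneg (fun _ _ => zero_le_one) _) (le_max_right _ _)

theorem inv_norm_le_one_add_truncInvNorm (ζ : ℂ) : ‖ζ‖⁻¹ ≤ 1 + truncInvNorm ζ := by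
  have := le_max_left (‖ζ‖⁻¹ - 1) 0
  unfold truncInvNorm
  linarith

theorem locallyIntegrable_inv : LocallyIntegrable (fun ζ : ℂ => ζ⁻¹) := by
  refine ((locallyIntegrable_const (1 : ℝ)).add
    integrable_truncInvNorm.locallyIntegrable).mono
    measurable_inv.aestronglyMeasurable (.of_forall fun ζ => ?_)
  rw [norm_inv]
  exact (inv_norm_le_one_add_truncInvNorm ζ).trans (le_abs_self _)

namespace DiskBounded

variable {A B : ℝ} {a b : ℂ → ℂ}

theorem nonneg (ha : DiskBounded A a) : 0 ≤ A := (norm_nonneg _).trans (ha.norm_le 0)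

theorem norm_div_le (ha : DiskBounded A a) (c ζ : ℂ) :
    ‖a ζ / (ζ - c)‖ ≤ A * kernelBound c ζ := by
  by_cases h : 1 ≤ ‖ζ‖
  · rw [ha.eq_zero ζ h, zero_div, norm_zero]
    exact mul_nonneg ha.nonneg (kernelBound_nonneg c ζ)
  · have h1 : kernelBound c ζ = 1 + truncInvNorm (ζ - c) := by
      rw [kernelBound, Set.indicator_of_mem (by simpa using h), Pi.one_apply]
    rw [div_eq_mul_inv, norm_mul, norm_inv, h1]
    exact mul_le_mul (ha.norm_le ζ) (inv_norm_le_one_add_truncInvNorm _) (by positivity) ha.nonneg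

theorem measurable_div (ha : DiskBounded A a) :
    Measurable fun p : ℂ × ℂ => a p.2 / (p.2 - p.1) :=
  (ha.measurable.comp measurable_snd).div (measurable_snd.sub measurable_fst)

theorem integrable_div (ha : DiskBounded A a) (c : ℂ) : Integrable fun ζ => a ζ / (ζ - c) :=
  ((integrable_kernelBound c).const_mul A).mono'
    (ha.measurable.div (measurable_id.sub_const c)).aestronglyMeasurable
    (.of_forall (ha.norm_div_le c))

theorem integral_norm_div_le (ha : DiskBounded A a) (c : ℂ) :
    ∫ ζ, ‖a ζ / (ζ - c)‖ ≤ A * (2 * Real.pi) := by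
  rw [← integral_kernelBound c, ← integral_const_mul]
  exact integral_mono (ha.integrable_div c).norm ((integrable_kernelBound c).const_mul A)
    (ha.norm_div_le c)

theorem norm_cauchyTransform_le (ha : DiskBounded A a) (c : ℂ) :
    ‖cauchyTransform a c‖ ≤ 2 * A := by
  rw [cauchyTransform, norm_smul, norm_neg, norm_inv, Real.norm_of_nonneg Real.pi_pos.le,
    inv_mul_le_iff₀ Real.pi_pos]
  calc _ ≤ _ := norm_integral_le_integral_norm _
    _ ≤ _ := ha.integral_norm_div_le c
    _ = _ := by ring

theorem measurable_cauchyTransform (ha : DiskBounded A a) : Measurable (cauchyTransform a) :=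
  Measurable.const_smul (ha.measurable_div.stronglyMeasurable.integral_prod_right'
    (ν := volume)).measurable (-(Real.pi)⁻¹)

theorem mul_bounded (ha : DiskBounded A a) {g : ℂ → ℂ} (hg : Measurable g)
    (hB : ∀ ζ, ‖g ζ‖ ≤ B) : DiskBounded (A * B) fun ζ => a ζ * g ζ where
  measurable := ha.measurable.mul hg
  norm_le ζ := by
    rw [norm_mul]
    exact mul_le_mul (ha.norm_le ζ) (hB ζ) (norm_nonneg _) ha.nonneg
  eq_zero ζ h := by rw [ha.eq_zero ζ h, zero_mul]

theorem const_mul (ha : DiskBounded A a) (k : ℂ) : DiskBounded (‖k‖ * A) fun ζ => k * a ζ where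
  measurable := ha.measurable.const_mul k
  norm_le ζ := by
    rw [norm_mul]
    exact mul_le_mul_of_nonneg_left (ha.norm_le ζ) (norm_nonneg _)
  eq_zero ζ h := by rw [ha.eq_zero ζ h, mul_zero]

theorem add (ha : DiskBounded A a) (hb : DiskBounded B b) :
    DiskBounded (A + B) fun ζ => a ζ + b ζ where
  measurable := ha.measurable.add hb.measurable
  norm_le ζ := (norm_add_le _ _).trans (add_le_add (ha.norm_le ζ) (hb.norm_le ζ))
  eq_zero ζ h := by rw [ha.eq_zero ζ h, hb.eq_zero ζ h, add_zero]

theorem cauchyTransform_add (ha : DiskBounded A a) (hb : DiskBounded B b) (c : ℂ) :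
    cauchyTransform (fun ζ => a ζ + b ζ) c = cauchyTransform a c + cauchyTransform b c := by
  simp only [cauchyTransform, add_div]
  rw [integral_add (ha.integrable_div c) (hb.integrable_div c), smul_add]

end DiskBounded

theorem cauchyTransform_const_mul (k : ℂ) (a : ℂ → ℂ) (c : ℂ) :
    cauchyTransform (fun ζ => k * a ζ) c = k * cauchyTransform a c := by
  simp only [cauchyTransform, mul_div_assoc]
  rw [integral_const_mul, mul_smul_comm]

namespace DiskBounded

variable {A B : ℝ} {a b : ℂ → ℂ}

theorem continuous_cauchyTransform (ha : DiskBounded A a) (hc : Continuous a) :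
    Continuous (cauchyTransform a) := by
  have hs : HasCompactSupport a :=
    HasCompactSupport.intro (isCompact_closedBall (0 : ℂ) 1) fun ζ hζ =>
      ha.eq_zero ζ (by simpa using (not_le.1 (by simpa using hζ)).le)
  have h := hs.continuous_convolution_left (ContinuousLinearMap.mul ℝ ℂ) hc
    locallyIntegrable_inv
  convert h.const_smul (Real.pi)⁻¹ using 1
  ext1 c
  rw [Pi.smul_apply, convolution_def, cauchyTransform, neg_smul, ← smul_neg, ← integral_neg]
  congr 2
  ext1 ζ
  rw [ContinuousLinearMap.mul_apply', ← neg_sub ζ c, inv_neg, div_eq_mul_inv, mul_neg]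

theorem integrable_div_mul_div (ha : DiskBounded A a) (hb : DiskBounded B b) (c : ℂ) :
    Integrable fun p : ℂ × ℂ => a p.1 / (p.1 - c) * (b p.2 / (p.2 - p.1)) := by
  have hm : Measurable fun p : ℂ × ℂ => a p.1 / (p.1 - c) * (b p.2 / (p.2 - p.1)) :=
    ((ha.measurable.comp measurable_fst).div (measurable_fst.sub_const c)).mul hb.measurable_div
  rw [Measure.volume_eq_prod, integrable_prod_iff hm.aestronglyMeasurable]
  refine ⟨.of_forall fun ζ => (hb.integrable_div ζ).const_mul (a ζ / (ζ - c)), ?_⟩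
  refine ((ha.integrable_div c).norm.mul_const (B * (2 * Real.pi))).mono'
    hm.norm.stronglyMeasurable.integral_prod_right'.aestronglyMeasurable (.of_forall fun ζ => ?_)
  simp only [norm_mul]
  rw [integral_const_mul, Real.norm_of_nonneg (by positivity)]
  exact mul_le_mul_of_nonneg_left (hb.integral_norm_div_le ζ) (norm_nonneg _)

theorem integral_integral_div_mul_div (a b : ℂ → ℂ) (c : ℂ) :
    ∫ ζ, ∫ η, a ζ / (ζ - c) * (b η / (η - ζ)) =
      Real.pi ^ 2 * cauchyTransform (fun ζ => a ζ * cauchyTransform b ζ) c := by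
  have h : ∀ ζ, a ζ * cauchyTransform b ζ / (ζ - c) =
      (-(Real.pi : ℂ)⁻¹) * ∫ η, a ζ / (ζ - c) * (b η / (η - ζ)) := by
    intro ζ
    rw [integral_const_mul, cauchyTransform, Complex.real_smul]
    push_cast
    ring
  have hpi : (Real.pi : ℂ) ≠ 0 := by exact_mod_cast Real.pi_ne_zero
  rw [cauchyTransform]
  simp only [h]
  rw [integral_const_mul, Complex.real_smul]
  push_cast
  field_simp

/-- The product of two Cauchy transforms is a Cauchy transform. -/
theorem cauchyTransform_mul (ha : DiskBounded A a) (hb : DiskBounded B b) (c : ℂ) :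
    cauchyTransform a c * cauchyTransform b c =
      cauchyTransform (fun ζ => a ζ * cauchyTransform b ζ) c +
        cauchyTransform (fun ζ => b ζ * cauchyTransform a ζ) c := by
  have hpi : (Real.pi : ℂ) ≠ 0 := by exact_mod_cast Real.pi_ne_zero
  have key : (∫ ζ, a ζ / (ζ - c)) * ∫ η, b η / (η - c) =
      (∫ ζ, ∫ η, a ζ / (ζ - c) * (b η / (η - ζ))) +
        ∫ η, ∫ ζ, b η / (η - c) * (a ζ / (ζ - η)) := by
    have hswap := (hb.integrable_div_mul_div ha c).swap
    have hsum := integral_integral_add (ha.integrable_div_mul_div hb c) hswap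
    rw [integral_integral_swap (f := fun η ζ => b η / (η - c) * (a ζ / (ζ - η)))
      (hb.integrable_div_mul_div ha c)]
    refine Eq.trans ?_ hsum
    rw [← integral_mul_const]
    refine integral_congr_ae ?_
    filter_upwards [compl_mem_ae_iff.2 (measure_singleton c)] with ζ hζ
    rw [← integral_const_mul]
    refine integral_congr_ae ?_
    filter_upwards [compl_mem_ae_iff.2 (measure_singleton c),
      compl_mem_ae_iff.2 (measure_singleton ζ)] with η hη hηζ
    have h1 : ζ - c ≠ 0 := sub_ne_zero.2 hζ
    have h2 : η - c ≠ 0 := sub_ne_zero.2 hη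
    have h3 : η - ζ ≠ 0 := sub_ne_zero.2 hηζ
    have h4 : ζ - η = -(η - ζ) := by ring
    simp only [Function.comp_apply, Prod.fst_swap, Prod.snd_swap, h4]
    field_simp
    ring
  rw [integral_integral_div_mul_div, integral_integral_div_mul_div, ← mul_add] at key
  rw [← mul_right_inj' (pow_ne_zero 2 hpi), ← key]
  simp only [cauchyTransform, Complex.real_smul]
  push_cast
  field_simp

theorem cauchyTransform_pow (ha : DiskBounded A a) (n : ℕ) (c : ℂ) :
    cauchyTransform a c ^ (n + 1) =
      (n + 1) * cauchyTransform (fun ζ => a ζ * cauchyTransform a ζ ^ n) c := by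
  induction n generalizing c with
  | zero => simp
  | succ n ih =>
    have hb : DiskBounded (A * (2 * A) ^ n) fun ζ => a ζ * cauchyTransform a ζ ^ n :=
      ha.mul_bounded (ha.measurable_cauchyTransform.pow_const n) fun ζ => by
        rw [norm_pow]
        exact pow_le_pow_left₀ (norm_nonneg _) (ha.norm_cauchyTransform_le ζ) n
    have h1 := ha.cauchyTransform_mul hb c
    have h2 : (fun ζ => a ζ * cauchyTransform (fun ζ => a ζ * cauchyTransform a ζ ^ n) ζ) =
        fun ζ => ((n : ℂ) + 1)⁻¹ * (a ζ * cauchyTransform a ζ ^ (n + 1)) := by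
      ext1 ζ
      have : (n : ℂ) + 1 ≠ 0 := by exact_mod_cast n.succ_ne_zero
      rw [ih]
      field_simp
    have h3 : (fun ζ => a ζ * cauchyTransform a ζ ^ n * cauchyTransform a ζ) =
        fun ζ => a ζ * cauchyTransform a ζ ^ (n + 1) := by
      ext1 ζ; ring
    rw [h2, h3, cauchyTransform_const_mul] at h1
    have : (n : ℂ) + 1 ≠ 0 := by exact_mod_cast n.succ_ne_zero
    rw [pow_succ', ih c, mul_left_comm, h1]
    push_cast
    field_simp
    ring

theorem norm_exp_cauchyTransform_le (ha : DiskBounded A a) (c : ℂ) :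
    ‖Complex.exp (cauchyTransform a c)‖ ≤ Real.exp (2 * A) := by
  rw [Complex.norm_exp]
  exact Real.exp_le_exp.2 ((Complex.re_le_norm _).trans (ha.norm_cauchyTransform_le c))

theorem cauchyTransform_mul_exp (ha : DiskBounded A a) (c : ℂ) :
    cauchyTransform (fun ζ => a ζ * Complex.exp (cauchyTransform a ζ)) c =
      Complex.exp (cauchyTransform a c) - 1 := by
  set S := cauchyTransform a with hS
  have hb : ∀ n : ℕ, DiskBounded (A * ((2 * A) ^ n / n.factorial))
      fun ζ => a ζ * (S ζ ^ n / n.factorial) := fun n =>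
    ha.mul_bounded ((ha.measurable_cauchyTransform.pow_const n).div_const _) fun ζ => by
      rw [norm_div, norm_pow, Complex.norm_natCast]
      gcongr
      exact ha.norm_cauchyTransform_le ζ
  have hsum : Summable fun n : ℕ => ∫ ζ, ‖a ζ * (S ζ ^ n / n.factorial) / (ζ - c)‖ := by
    refine Summable.of_nonneg_of_le (fun n => integral_nonneg fun ζ => norm_nonneg _)
      (fun n => (hb n).integral_norm_div_le c) ?_
    exact ((Real.summable_pow_div_factorial (2 * A)).mul_left A).mul_right _
  have h1 := hasSum_integral_of_summable_integral_norm (fun n => (hb n).integrable_div c) hsum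
  have hexp : ∀ w : ℂ, HasSum (fun n : ℕ => w ^ n / n.factorial) (Complex.exp w) := fun w => by
    rw [Complex.exp_eq_exp_ℂ]
    exact NormedSpace.expSeries_div_hasSum_exp w
  have h2 : (fun ζ => ∑' n : ℕ, a ζ * (S ζ ^ n / n.factorial) / (ζ - c)) =
      fun ζ => a ζ * Complex.exp (S ζ) / (ζ - c) := by
    ext1 ζ
    exact (((hexp (S ζ)).mul_left (a ζ)).div_const _).tsum_eq
  rw [h2] at h1
  have h3 := h1.const_smul (-(Real.pi)⁻¹)
  have h4 : ∀ n : ℕ, (-(Real.pi)⁻¹) • ∫ ζ, a ζ * (S ζ ^ n / n.factorial) / (ζ - c) =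
      S c ^ (n + 1) / (n + 1).factorial := by
    intro n
    have h5 : (fun ζ => a ζ * (S ζ ^ n / n.factorial)) =
        fun ζ => ((n.factorial : ℂ))⁻¹ * (a ζ * S ζ ^ n) := by
      ext1 ζ; ring
    change cauchyTransform (fun ζ => a ζ * (S ζ ^ n / n.factorial)) c = _
    rw [h5, cauchyTransform_const_mul, hS, ha.cauchyTransform_pow, Nat.factorial_succ]
    have h6 : (n : ℂ) + 1 ≠ 0 := by exact_mod_cast n.succ_ne_zero
    have h7 : (n.factorial : ℂ) ≠ 0 := by exact_mod_cast n.factorial_ne_zero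
    push_cast
    field_simp
  simp only [h4] at h3
  have h8 := (hasSum_nat_add_iff' 1).2 (hexp (S c))
  simp only [Finset.range_one, Finset.sum_singleton, pow_zero, Nat.factorial_zero, Nat.cast_one,
    div_one] at h8
  exact h3.unique h8

/-- A priori bound for the linear equation `v = C(a (v + g))`, where `C` is the Cauchy
transform. -/
theorem norm_le_of_eq_cauchyTransform (ha : DiskBounded A a) {v g : ℂ → ℂ} {V G : ℝ}
    (hvm : Measurable v) (hgm : Measurable g) (hv : ∀ ζ, ‖v ζ‖ ≤ V) (hg : ∀ ζ, ‖g ζ‖ ≤ G)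
    (h : ∀ c, v c = cauchyTransform (fun ζ => a ζ * (v ζ + g ζ)) c) (c : ℂ) :
    ‖v c‖ ≤ Real.exp (2 * A) * (2 * (A * Real.exp (2 * A) * G)) := by
  have ha' : DiskBounded A fun ζ => (-1 : ℂ) * a ζ := by simpa using ha.const_mul (-1)
  set T := cauchyTransform fun ζ => (-1 : ℂ) * a ζ with hT
  have hTm : Measurable T := ha'.measurable_cauchyTransform
  set w : ℂ → ℂ := fun ζ => Complex.exp (T ζ) with hw
  have hwm : Measurable w := Complex.measurable_exp.comp hTm
  have hwb : ∀ ζ, ‖w ζ‖ ≤ Real.exp (2 * A) := ha'.norm_exp_cauchyTransform_le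
  have h1 : DiskBounded _ fun ζ => (-1 : ℂ) * a ζ * w ζ := ha'.mul_bounded hwm hwb
  have h2 : DiskBounded _ fun ζ => a ζ * (v ζ + g ζ) :=
    ha.mul_bounded (hvm.add hgm) fun ζ => (norm_add_le _ _).trans (add_le_add (hv ζ) (hg ζ))
  have hw1 : cauchyTransform (fun ζ => (-1 : ℂ) * a ζ * w ζ) = fun c => w c - 1 :=
    funext ha'.cauchyTransform_mul_exp
  have hv1 : cauchyTransform (fun ζ => a ζ * (v ζ + g ζ)) = v := funext fun c => (h c).symm
  have h3 : DiskBounded _ fun ζ => a ζ * w ζ * g ζ := (ha.mul_bounded hwm hwb).mul_bounded hgm hg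
  have hprod := h1.cauchyTransform_mul h2 c
  rw [hw1, hv1] at hprod
  have h4 : DiskBounded _ fun ζ => (-1 : ℂ) * a ζ * w ζ * v ζ := h1.mul_bounded hvm hv
  have h5 : DiskBounded _ fun ζ => a ζ * (v ζ + g ζ) * (w ζ - 1) :=
    h2.mul_bounded (hwm.sub_const 1) fun ζ =>
      (norm_sub_le _ _).trans (add_le_add_left (hwb ζ) ‖(1 : ℂ)‖)
  have h6 : w c * v c = cauchyTransform (fun ζ => a ζ * w ζ * g ζ) c := by
    rw [← h4.cauchyTransform_add h5] at hprod
    have hadd := (h4.add h5).cauchyTransform_add h2 c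
    rw [← hprod, hv1] at hadd
    have : (fun ζ => (-1 : ℂ) * a ζ * w ζ * v ζ + a ζ * (v ζ + g ζ) * (w ζ - 1) +
        a ζ * (v ζ + g ζ)) = fun ζ => a ζ * w ζ * g ζ := by
      ext1 ζ; ring
    rw [this] at hadd
    rw [hadd]
    ring
  have h7 : v c = Complex.exp (-T c) * (w c * v c) := by
    rw [hw, ← mul_assoc, ← Complex.exp_add, neg_add_cancel, Complex.exp_zero, one_mul]
  rw [h7, h6, norm_mul]
  refine mul_le_mul ?_ (h3.norm_cauchyTransform_le c) (norm_nonneg _) (Real.exp_pos _).le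
  rw [Complex.norm_exp]
  refine Real.exp_le_exp.2 ((Complex.re_le_norm _).trans ?_)
  rw [norm_neg]
  exact ha'.norm_cauchyTransform_le c

theorem tendsto_cauchyTransform_cobounded (ha : DiskBounded A a) :
    Filter.Tendsto (cauchyTransform a) (Bornology.cobounded ℂ) (nhds 0) := by
  have hint : Integrable fun ζ => A * (Metric.ball (0 : ℂ) 1).indicator (1 : ℂ → ℝ) ζ :=
    integrable_indicator_ball.const_mul A
  have hcg : (Bornology.cobounded ℂ).IsCountablyGenerated := by
    rw [← comap_norm_atTop]
    infer_instance
  have h : Filter.Tendsto (fun c => ∫ ζ, a ζ / (ζ - c)) (Bornology.cobounded ℂ)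
      (nhds (∫ _ : ℂ, (0 : ℂ))) := by
    refine tendsto_integral_filter_of_dominated_convergence _
      (.of_forall fun c => (ha.integrable_div c).aestronglyMeasurable) ?_ hint
      (.of_forall fun ζ => ?_)
    · filter_upwards [tendsto_norm_cobounded_atTop.eventually_ge_atTop 2] with c hc
      refine .of_forall fun ζ => ?_
      by_cases h : 1 ≤ ‖ζ‖
      · rw [ha.eq_zero ζ h, zero_div, norm_zero]
        exact mul_nonneg ha.nonneg (Set.indicator_nonneg (fun _ _ => zero_le_one) _)
      · rw [Set.indicator_of_mem (by simpa using h), Pi.one_apply, mul_one, norm_div]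
        have h1 : 1 ≤ ‖ζ - c‖ := by
          have := norm_sub_norm_le c ζ
          rw [norm_sub_rev] at this
          linarith
        exact (div_le_self (norm_nonneg _) h1).trans (ha.norm_le ζ)
    · have := (Filter.tendsto_inv₀_cobounded (α := ℂ)).comp
        (tendsto_const_sub_cobounded ζ)
      simpa [div_eq_mul_inv] using this.const_mul (a ζ)
  have h' := h.const_smul (-(Real.pi)⁻¹)
  rw [integral_zero, smul_zero] at h'
  exact h'

end DiskBounded

/-- Method of continuity for Lipschitz maps: if `f ↦ f - t • N f` expands distances by a factor
at least `M⁻¹`, uniformly in `t ∈ [0, 1]`, then `f ↦ f - N f` is surjective. -/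
theorem exists_sub_eq_of_norm_sub_le {E : Type*} [NormedAddCommGroup E] [NormedSpace ℝ E]
    [CompleteSpace E] {N : E → E} {K M : ℝ} (hK : 0 ≤ K) (hM : 0 ≤ M)
    (hN : ∀ f f', ‖N f - N f'‖ ≤ K * ‖f - f'‖)
    (hexp : ∀ t : ℝ, 0 ≤ t → t ≤ 1 → ∀ f f',
      ‖f - f'‖ ≤ M * ‖(f - t • N f) - (f' - t • N f')‖) (g : E) :
    ∃ f, f - N f = g := by
  obtain ⟨n, hn⟩ := exists_nat_gt (M * K)
  have hn0 : (0 : ℝ) < n := (mul_nonneg hM hK).trans_lt hn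
  have main : ∀ k : ℕ, k ≤ n → ∀ g, ∃ f, f - ((k : ℝ) / n) • N f = g := by
    intro k
    induction k with
    | zero => exact fun _ g => ⟨g, by simp⟩
    | succ k ih =>
      intro hk g
      choose R hR using ih (Nat.le_of_succ_le hk)
      have hk1 : (k : ℝ) / n ≤ 1 :=
        (div_le_one hn0).2 (by exact_mod_cast Nat.le_of_succ_le hk)
      have hRlip : ∀ x y, ‖R x - R y‖ ≤ M * ‖x - y‖ := fun x y => by
        simpa only [hR] using hexp (k / n) (by positivity) hk1 (R x) (R y)
      have hcon : ContractingWith (M * K / n).toNNReal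
          fun f => R (g + (n : ℝ)⁻¹ • N f) := by
        refine ⟨Real.toNNReal_lt_one.2 ((div_lt_one hn0).2 hn),
          LipschitzWith.of_dist_le_mul fun x y => ?_⟩
        rw [Real.coe_toNNReal _ (by positivity), dist_eq_norm, dist_eq_norm]
        refine (hRlip _ _).trans ?_
        rw [add_sub_add_left_eq_sub, ← smul_sub, norm_smul, norm_inv, Real.norm_natCast]
        calc M * ((n : ℝ)⁻¹ * ‖N x - N y‖) ≤ M * ((n : ℝ)⁻¹ * (K * ‖x - y‖)) := by
              gcongr
              exact hN x y
          _ = _ := by ring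
      have hfix := hcon.fixedPoint_isFixedPt
      set f := ContractingWith.fixedPoint _ hcon
      refine ⟨f, ?_⟩
      have h1 := hR (g + (n : ℝ)⁻¹ • N f)
      rw [show R (g + (n : ℝ)⁻¹ • N f) = f from hfix] at h1
      rw [Nat.cast_succ, add_div, add_smul, ← sub_sub, h1, one_div, add_sub_cancel_right]
  obtain ⟨f, hf⟩ := main n le_rfl g
  exact ⟨f, by rwa [div_self hn0.ne', one_smul] at hf⟩

/-- If `Φ : ℂ × ℂ → ℂ` is continuous, bounded by `C₅ > 0`, vanishes when
`|c| ≥ 1`, and is Lipschitz in the second variable with constant `L > 0`, then for every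
`z ∈ ℂ` there exists a bounded continuous `f : ℂ → ℂ` with `sup |f| ≤ |z| + 2 C₅`,
satisfying the fixed-point equation `f(c) = z + 𝒦f(c)` for all `c ∈ ℂ` and `f(c) → z`
as `c → ∞`. -/
theorem KOp_fixedPoint_exists
    (C₅ : ℝ) (hC₅ : 0 < C₅) (L : ℝ) (hL : 0 < L) (Φ : ℂ → ℂ → ℂ)
    (hΦcont : Continuous (Function.uncurry Φ))
    (hΦbdd : ∀ c w : ℂ, ‖Φ c w‖ ≤ C₅)
    (hΦsupp : ∀ c w : ℂ, 1 ≤ ‖c‖ → Φ c w = 0)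
    (hΦlip : ∀ c w w' : ℂ, ‖Φ c w - Φ c w'‖ ≤ L * ‖w - w'‖)
    (z : ℂ) :
    ∃ f : ℂ → ℂ, Continuous f ∧
      (∀ c : ℂ, ‖f c‖ ≤ ‖z‖ + 2 * C₅) ∧
      (∀ c : ℂ, f c = z + KOp Φ f c) ∧
      Filter.Tendsto f (Bornology.cobounded ℂ) (nhds z) := by
  have hcont : ∀ f : ℂ → ℂ, Continuous f → Continuous fun ζ => Φ ζ (f ζ) := fun f hf =>
    hΦcont.comp (continuous_id.prodMk hf)
  have hdisk : ∀ f : ℂ → ℂ, Continuous f → DiskBounded C₅ fun ζ => Φ ζ (f ζ) := fun f hf =>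
    ⟨(hcont f hf).measurable, fun ζ => hΦbdd ζ _, fun ζ => hΦsupp ζ _⟩
  let N : BoundedContinuousFunction ℂ ℂ → BoundedContinuousFunction ℂ ℂ := fun f =>
    BoundedContinuousFunction.ofNormedAddCommGroup (KOp Φ f)
      ((hdisk f f.continuous).continuous_cauchyTransform (hcont f f.continuous)) (2 * C₅)
      (hdisk f f.continuous).norm_cauchyTransform_le
  have hNapp : ∀ f c, N f c = KOp Φ f c := fun _ _ => rfl
  let a : BoundedContinuousFunction ℂ ℂ → BoundedContinuousFunction ℂ ℂ → ℂ → ℂ :=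
    fun f f' ζ => (Φ ζ (f ζ) - Φ ζ (f' ζ)) / (f ζ - f' ζ)
  have ha : ∀ f f', DiskBounded L (a f f') := fun f f' =>
    { measurable := ((hcont f f.continuous).sub (hcont f' f'.continuous)).measurable.div
        (f.continuous.sub f'.continuous).measurable
      norm_le := fun ζ => by
        rw [norm_div]
        exact div_le_of_le_mul₀ (norm_nonneg _) hL.le (hΦlip ζ _ _)
      eq_zero := fun ζ h => by simp [a, hΦsupp ζ _ h] }
  have hdiff : ∀ f f' c, N f c - N f' c = cauchyTransform (fun ζ => a f f' ζ * (f ζ - f' ζ)) c := by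
    intro f f' c
    have h1 : ∀ ζ, Φ ζ (f ζ) = a f f' ζ * (f ζ - f' ζ) + Φ ζ (f' ζ) := fun ζ => by
      by_cases h : f ζ - f' ζ = 0
      · simp [sub_eq_zero.1 h]
      · rw [div_mul_cancel₀ _ h, sub_add_cancel]
    have h2 : DiskBounded (L * ‖f - f'‖) fun ζ => a f f' ζ * (f ζ - f' ζ) :=
      (ha f f').mul_bounded (f.continuous.sub f'.continuous).measurable
        fun ζ => (f - f').norm_coe_le_norm ζ
    rw [hNapp, hNapp, KOp_eq_cauchyTransform, KOp_eq_cauchyTransform, sub_eq_iff_eq_add,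
      ← h2.cauchyTransform_add (hdisk f' f'.continuous)]
    exact congrArg (fun b => cauchyTransform b c) (funext h1)
  have hNlip : ∀ f f', ‖N f - N f'‖ ≤ 2 * L * ‖f - f'‖ := by
    intro f f'
    refine (BoundedContinuousFunction.norm_le (by positivity)).2 fun c => ?_
    rw [BoundedContinuousFunction.sub_apply, hdiff, mul_assoc]
    exact ((ha f f').mul_bounded (f.continuous.sub f'.continuous).measurable
      fun ζ => (f - f').norm_coe_le_norm ζ).norm_cauchyTransform_le c
  let M₀ : ℝ := Real.exp (2 * L) * (2 * (L * Real.exp (2 * L)))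
  have hexp : ∀ t : ℝ, 0 ≤ t → t ≤ 1 → ∀ f f',
      ‖f - f'‖ ≤ (M₀ + 1) * ‖(f - t • N f) - (f' - t • N f')‖ := by
    intro t ht0 ht1 f f'
    set g := (f - t • N f) - (f' - t • N f') with hg
    set v := f - f' - g with hv
    have hvt : ∀ c, v c = t * (N f c - N f' c) := fun c => by
      simp [hv, hg]
      ring
    have hta : DiskBounded L fun ζ => (t : ℂ) * a f f' ζ :=
      { measurable := (ha f f').measurable.const_mul _
        norm_le := fun ζ => by
          refine (((ha f f').const_mul t).norm_le ζ).trans (mul_le_of_le_one_left hL.le ?_)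
          rwa [Complex.norm_real, Real.norm_of_nonneg ht0]
        eq_zero := ((ha f f').const_mul t).eq_zero }
    have hvb : ‖v‖ ≤ M₀ * ‖g‖ := by
      refine (BoundedContinuousFunction.norm_le (by positivity)).2 fun c => ?_
      refine (hta.norm_le_of_eq_cauchyTransform v.continuous.measurable g.continuous.measurable
        v.norm_coe_le_norm g.norm_coe_le_norm (fun c => ?_) c).trans_eq (by ring)
      rw [hvt, hdiff, ← cauchyTransform_const_mul]
      congr 1
      ext1 ζ
      simp [hv]
      ring
    calc ‖f - f'‖ = ‖v + g‖ := by rw [hv, sub_add_cancel]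
      _ ≤ ‖v‖ + ‖g‖ := norm_add_le _ _
      _ ≤ M₀ * ‖g‖ + ‖g‖ := by gcongr
      _ = _ := by ring
  obtain ⟨f, hf⟩ := exists_sub_eq_of_norm_sub_le (by positivity) (by positivity) hNlip hexp
    (BoundedContinuousFunction.const ℂ z)
  have hfix : ∀ c, f c = z + KOp Φ f c := fun c => by
    rw [← hNapp, ← sub_eq_iff_eq_add]
    exact DFunLike.congr_fun hf c
  have hd := hdisk f f.continuous
  refine ⟨f, f.continuous, fun c => ?_, hfix, ?_⟩
  · rw [hfix]
    exact (norm_add_le _ _).trans (add_le_add_right (hd.norm_cauchyTransform_le c) ‖z‖)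
  · have h := hd.tendsto_cauchyTransform_cobounded.const_add z
    rw [add_zero] at h
    exact h.congr fun c => (hfix c).symm
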